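/- Let c > 0 and 0 < R ≤ x be real numbers, and set s = (1/c)·(1 − R/x). Then 0 ≤ s < 1/c and e^{−s x} · (1 − s c)^{−R/c} ≤ e^{−(x − 2R)/(2c)}. -/

import Mathlib

/-- The logarithm lies below the line of slope `1 / 2` through the origin. -/
theorem Real.two_mul_log_le_self {t : ℝ} (ht : 0 < t) : 2 * Real.log t ≤ t := by
  have h := Real.log_le_sub_one_of_pos (half_pos ht)
  rw [Real.log_div ht.ne' two_ne_zero] at h
  linarith [Real.log_two_lt_d9]

/-- The calculus optimization step in the proof of the leakage-suppression lemma: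
with `s = (1/c)(1 − R/x)`, one has `0 ≤ s < 1/c` and
`e^{−sx}(1 − sc)^{−R/c} ≤ e^{−(x−2R)/(2c)}`. -/
theorem exp_rpow_optimization
    {c R x : ℝ} (hc : 0 < c) (hR : 0 < R) (hRx : R ≤ x)
    (s : ℝ) (hs : s = (1 / c) * (1 - R / x)) :
    0 ≤ s ∧ s < 1 / c ∧
      Real.exp (-s * x) * (1 - s * c) ^ (-(R / c) : ℝ) ≤
        Real.exp (-(x - 2 * R) / (2 * c)) := by
  have hx : 0 < x := hR.trans_le hRx
  have hsx : s * x = (x - R) / c := by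
    rw [hs]
    field_simp
  have hsc : 1 - s * c = R / x := by
    rw [hs]
    field_simp
    ring
  refine ⟨?_, ?_, ?_⟩
  · rw [hs]
    exact mul_nonneg (by positivity) (sub_nonneg.2 ((div_le_one hx).2 hRx))
  · rw [hs]
    exact mul_lt_of_lt_one_right (by positivity) (sub_lt_self _ (by positivity))
  · rw [hsc, Real.rpow_def_of_pos (by positivity), ← Real.exp_add, Real.exp_le_exp,
      neg_mul, hsx, ← inv_div x R, Real.log_inv]
    have hlog : 2 * R * Real.log (x / R) ≤ x := by
      have h := mul_le_mul_of_nonneg_left (Real.two_mul_log_le_self (div_pos hx hR)) hR.le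
      rw [mul_div_cancel₀ x hR.ne'] at h
      linarith
    calc -((x - R) / c) + -Real.log (x / R) * -(R / c)
        = (-(2 * x - 2 * R) + 2 * R * Real.log (x / R)) / (2 * c) := by
          field_simp
      _ ≤ -(x - 2 * R) / (2 * c) := by
          gcongr
          linarith
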